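/- Let G be a directed cyclic graph containing a cycle C, let H = Reverse(G, C), and let C̄ denote the reversed cycle of C as it occurs in H. Then: (1) every vertex has exactly the same set of descendants in H as in G; and (2) Reverse(H, C̄) = G. -/

import Mathlib

namespace CausalMEC

/-- A directed graph on `Fin n`, given by a Boolean edge function (`d a b = true` means `a → b`). -/
abbrev Dir (n : ℕ) := Fin n → Fin n → Bool

/-- Directed reachability (zero or more steps). -/
def Reach {n : ℕ} (d : Dir n) : Fin n → Fin n → Prop :=
  Relation.ReflTransGen fun a b => d a b = true

/-- No directed cycles (including no self-loops). -/
def Acyclic {n : ℕ} (d : Dir n) : Prop :=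
  ∀ v, ¬ Relation.TransGen (fun a b => d a b = true) v v

/-- A directed acyclic graph. -/
def IsDAG {n : ℕ} (d : Dir n) : Prop :=
  (∀ v, d v v = false) ∧ Acyclic d

/-- A directed (possibly cyclic) graph with edges between distinct vertices. -/
def IsDCG {n : ℕ} (d : Dir n) : Prop :=
  ∀ v, d v v = false

/-- The number of directed edges. -/
def edgeCount {n : ℕ} (d : Dir n) : ℕ :=
  (Finset.univ.filter fun q : Fin n × Fin n => d q.1 q.2 = true).card

/-- The parent set of a vertex. -/
def parents {n : ℕ} (d : Dir n) (v : Fin n) : Finset (Fin n) :=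
  Finset.univ.filter fun u => d u v = true

/-! ### Paths, d-connection and Markov equivalence in mixed graphs
A mixed graph is given by a directed part `d` and a bidirected part `b`. -/

/-- The kind of a step on a path: a directed edge traversed forwards, a directed edge
traversed backwards, or a bidirected edge. -/
inductive EdgeKind : Type
  | fwd | bwd | bidir
deriving DecidableEq

/-- Does the step point into its second endpoint? -/
def EdgeKind.intoSnd : EdgeKind → Bool
  | .fwd => true
  | .bwd => false
  | .bidir => true

/-- Does the step point into its first endpoint? -/
def EdgeKind.intoFst : EdgeKind → Bool
  | .fwd => false
  | .bwd => true
  | .bidir => true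

/-- A (possibly self-intersecting) path from `u` to `v` in the mixed graph `(d, b)`. -/
structure MPath {n : ℕ} (d b : Dir n) (u v : Fin n) where
  len : ℕ
  vert : Fin (len + 1) → Fin n
  kind : Fin len → EdgeKind
  first_eq : vert 0 = u
  last_eq : vert (Fin.last len) = v
  valid : ∀ i : Fin len,
    (kind i = .fwd → d (vert i.castSucc) (vert i.succ) = true) ∧
    (kind i = .bwd → d (vert i.succ) (vert i.castSucc) = true) ∧
    (kind i = .bidir → b (vert i.castSucc) (vert i.succ) = true)

/-- Whether the internal vertex at position `i` of a path is a collider. -/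
def MPath.colliderAt {n : ℕ} {d b : Dir n} {u v : Fin n} (π : MPath d b u v)
    (i : ℕ) (h1 : 0 < i) (h2 : i < π.len) : Bool :=
  (π.kind ⟨i - 1, by omega⟩).intoSnd && (π.kind ⟨i, h2⟩).intoFst

/-- A path is active given a conditioning set `Z` if every non-collider on it avoids `Z`
and every collider on it is in `Z` or has a descendant in `Z`. -/
def MPath.Active {n : ℕ} {d b : Dir n} {u v : Fin n} (π : MPath d b u v)
    (Z : Finset (Fin n)) : Prop :=
  ∀ (i : ℕ) (h1 : 0 < i) (h2 : i < π.len),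
    (π.colliderAt i h1 h2 = true →
      ∃ x ∈ Z, Reach d (π.vert ⟨i, by omega⟩) x) ∧
    (π.colliderAt i h1 h2 = false →
      π.vert ⟨i, by omega⟩ ∉ Z)

/-- d-connection given a conditioning set. -/
def DConn {n : ℕ} (d b : Dir n) (u v : Fin n) (Z : Finset (Fin n)) : Prop :=
  ∃ π : MPath d b u v, π.Active Z

/-- Markov equivalence of two mixed graphs: the same d-connection relations. -/
def MarkovEquiv {n : ℕ} (d b d' b' : Dir n) : Prop :=
  ∀ (u v : Fin n) (Z : Finset (Fin n)), u ≠ v → u ∉ Z → v ∉ Z →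
    (DConn d b u v Z ↔ DConn d' b' u v Z)

/-- The empty bidirected part: a purely directed graph. -/
def noBi (n : ℕ) : Dir n := fun _ _ => false

/-- Markov equivalence for purely directed graphs. -/
def MarkovEquivD {n : ℕ} (d d' : Dir n) : Prop :=
  MarkovEquiv d (noBi n) d' (noBi n)

/-- The Markov equivalence class of a DAG (within DAGs). -/
def MECdag {n : ℕ} (d : Dir n) : Set (Dir n) :=
  {d' | IsDAG d' ∧ MarkovEquivD d d'}

/-- An acyclic directed mixed graph. -/
def IsADMG {n : ℕ} (d b : Dir n) : Prop :=
  IsDAG d ∧ (∀ v w, b v w = b w v) ∧ (∀ v, b v v = false)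

/-- The Markov equivalence class of an ADMG (within ADMGs). -/
def MECadmg {n : ℕ} (d b : Dir n) : Set (Dir n × Dir n) :=
  {G | IsADMG G.1 G.2 ∧ MarkovEquiv d b G.1 G.2}

/-- The Markov equivalence class of a DCG (within DCGs). -/
def MECdcg {n : ℕ} (d : Dir n) : Set (Dir n) :=
  {d' | IsDCG d' ∧ MarkovEquivD d d'}

/-! ### The distribution `D(n,p)` and uniform ADMGs/DCGs -/

/-- The (unnormalized) weight of a DAG under `D(n,p)`. -/
noncomputable def dagWeight {n : ℕ} (p : ℝ) (d : Dir n) : ℝ :=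
  (p / (1 - p)) ^ edgeCount d

open scoped Classical in
/-- Probability of the event `A` under `D(n,p)`. -/
noncomputable def prD (n : ℕ) (p : ℝ) (A : Dir n → Prop) : ℝ :=
  (∑ d : Dir n, if IsDAG d ∧ A d then dagWeight p d else 0) /
    (∑ d : Dir n, if IsDAG d then dagWeight p d else 0)

open scoped Classical in
/-- Expectation of `f` under `D(n,p)`. -/
noncomputable def expD (n : ℕ) (p : ℝ) (f : Dir n → ℝ) : ℝ :=
  (∑ d : Dir n, if IsDAG d then f d * dagWeight p d else 0) /
    (∑ d : Dir n, if IsDAG d then dagWeight p d else 0)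

/-- Conditional probability of `A` given `B` under `D(n,p)`. -/
noncomputable def condPrD (n : ℕ) (p : ℝ) (A B : Dir n → Prop) : ℝ :=
  prD n p (fun d => A d ∧ B d) / prD n p B

open scoped Classical in
/-- Expectation of `f` under the uniform distribution on ADMGs on `n` vertices. -/
noncomputable def expADMG (n : ℕ) (f : Dir n × Dir n → ℝ) : ℝ :=
  (∑ G : Dir n × Dir n, if IsADMG G.1 G.2 then f G else 0) /
    (∑ G : Dir n × Dir n, if IsADMG G.1 G.2 then (1 : ℝ) else 0)

open scoped Classical in
/-- Expectation of `f` under the uniform distribution on DCGs on `n` vertices. -/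
noncomputable def expDCG (n : ℕ) (f : Dir n → ℝ) : ℝ :=
  (∑ d : Dir n, if IsDCG d then f d else 0) /
    (∑ d : Dir n, if IsDCG d then (1 : ℝ) else 0)

open scoped Classical in
/-- Probability of the event `A` under the uniform distribution on DCGs on `n` vertices. -/
noncomputable def prDCG (n : ℕ) (A : Dir n → Prop) : ℝ :=
  (∑ d : Dir n, if IsDCG d ∧ A d then (1 : ℝ) else 0) /
    (∑ d : Dir n, if IsDCG d then (1 : ℝ) else 0)

/-! ### Tower decomposition -/

/-- The sources of `d` within a vertex set `S` (no parents inside `S`). -/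
def sourcesIn {n : ℕ} (d : Dir n) (S : Finset (Fin n)) : Finset (Fin n) :=
  S.filter fun v => ∀ u ∈ S, d u v = false

/-- The vertices remaining after peeling off `k` layers of sources. -/
def remaining {n : ℕ} (d : Dir n) : ℕ → Finset (Fin n)
  | 0 => Finset.univ
  | k + 1 => remaining d k \ sourcesIn d (remaining d k)

/-- The `i`-th layer (1-based) of the tower decomposition of `d`. -/
def towerLayer {n : ℕ} (d : Dir n) (i : ℕ) : Finset (Fin n) :=
  sourcesIn d (remaining d (i - 1))

/-- The 1-based index of the layer containing `v`. -/
def layerIdx {n : ℕ} (d : Dir n) (v : Fin n) : ℕ :=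
  ((Finset.range n).filter fun j => v ∈ remaining d j).card

/-- The tower of a DAG: only the edges between adjacent layers are kept. -/
def tower {n : ℕ} (d : Dir n) : Dir n :=
  fun a c => d a c && decide (layerIdx d c = layerIdx d a + 1)

/-- `h` is the tower vector of `d` (layer sizes, 1-based, and no further layers). -/
def hasTowerVector {n : ℕ} (d : Dir n) (h : List ℕ) : Prop :=
  (∀ i : Fin h.length, (towerLayer d (i.val + 1)).card = h.get i) ∧
    towerLayer d (h.length + 1) = ∅

/-- `H` is the tower decomposition of `d`. -/
def hasTowerDecomp {n : ℕ} (d : Dir n) (H : List (Finset (Fin n))) : Prop :=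
  (∀ i : Fin H.length, towerLayer d (i.val + 1) = H.get i) ∧
    towerLayer d (H.length + 1) = ∅

/-- The weight `w(h)` of a tower vector `h = (h_1, …, h_s)`. -/
noncomputable def towerWeight (p : ℝ) (h : List ℕ) : ℝ :=
  (Nat.multinomial Finset.univ (fun i : Fin h.length => h.get i) : ℝ) *
    ∏ k ∈ Finset.Icc 2 h.length,
      (1 - (1 - p) ^ h.getD (k - 2) 0) ^ h.getD (k - 1) 0 /
        (1 - p) ^ (h.getD (k - 1) 0 * ∑ i ∈ Finset.range (k - 1), h.getD i 0)

/-! ### Edge reversal and deletion -/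

/-- Reverse the edge `v → w`. -/
def reverseEdge {n : ℕ} (d : Dir n) (v w : Fin n) : Dir n :=
  fun a c => if a = v ∧ c = w then false else if a = w ∧ c = v then true else d a c

/-- Delete the edge `v → w`. -/
def deleteEdge {n : ℕ} (d : Dir n) (v w : Fin n) : Dir n :=
  fun a c => if a = v ∧ c = w then false else d a c

/-- The edge `v → w` of a DAG is reversible: reversing it yields a Markov-equivalent DAG. -/
def Reversible {n : ℕ} (d : Dir n) (v w : Fin n) : Prop :=
  d v w = true ∧ IsDAG (reverseEdge d v w) ∧ MarkovEquivD d (reverseEdge d v w)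

/-- `d` has a matching of reversible layer-2-edges of size at least `m`. -/
def hasRevL2Matching {n : ℕ} (d : Dir n) (m : ℝ) : Prop :=
  ∃ S : Finset (Fin n × Fin n),
    (∀ e ∈ S, Reversible d e.1 e.2 ∧ e.2 ∈ towerLayer d 2) ∧
    (∀ e ∈ S, ∀ e' ∈ S, e ≠ e' →
      e.1 ≠ e'.1 ∧ e.1 ≠ e'.2 ∧ e.2 ≠ e'.1 ∧ e.2 ≠ e'.2) ∧
    m ≤ (S.card : ℝ)

/-! ### Cycles and the `Reverse` construction -/

/-- Cyclic successor in `Fin k`. -/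
def cycSucc {k : ℕ} (i : Fin k) : Fin k :=
  ⟨(i.val + 1) % k, Nat.mod_lt _ i.pos⟩

/-- The reversed parametrization of a cycle. -/
def cycRev {n k : ℕ} (c : Fin k → Fin n) : Fin k → Fin n :=
  fun i => c ⟨(k - i.val) % k, Nat.mod_lt _ i.pos⟩

/-- `c` lists the (distinct) vertices of a directed cycle of `d`, in order. -/
def IsCycle {n k : ℕ} (d : Dir n) (c : Fin k → Fin n) : Prop :=
  Function.Injective c ∧ ∀ i, d (c i) (c (cycSucc i)) = true

/-- The `Reverse(G, C)` construction: reverse the cycle `c` and redirect every edge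
`w → v_i` with `w ∈ Pa(v_i) \ {v_{i-1}}` to `w → v_{i-1}`. -/
def reverseCycle {n k : ℕ} (d : Dir n) (c : Fin k → Fin n) : Dir n :=
  fun a e =>
    decide ((∃ j : Fin k, e = c j ∧
        (a = c (cycSucc j) ∨ (d a (c (cycSucc j)) = true ∧ a ≠ c j))) ∨
      ((∀ j : Fin k, e ≠ c j) ∧ d a e = true))

/-- A vertex triple induces exactly a directed 3-cycle. -/
def induces3Cycle {n : ℕ} (d : Dir n) (W : Finset (Fin n)) : Prop :=
  ∃ a b c : Fin n, W = {a, b, c} ∧ a ≠ b ∧ a ≠ c ∧ b ≠ c ∧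
    d a b = true ∧ d b c = true ∧ d c a = true ∧
    d b a = false ∧ d c b = false ∧ d a c = false

theorem cycSucc_iterate_val {k : ℕ} (i : Fin k) (t : ℕ) :
    (cycSucc^[t] i).val = (i.val + t) % k := by
  induction t with
  | zero => simp [Nat.mod_eq_of_lt i.isLt]
  | succ t ih =>
    rw [Function.iterate_succ_apply']
    simp only [cycSucc, ih, Nat.mod_add_mod, Nat.add_assoc]

theorem exists_cycSucc_iterate_eq {k : ℕ} (i j : Fin k) : ∃ t, cycSucc^[t] i = j := by
  refine ⟨j.val + k - i.val, Fin.ext ?_⟩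
  rw [cycSucc_iterate_val, show i.val + (j.val + k - i.val) = j.val + k by omega,
    Nat.add_mod_right, Nat.mod_eq_of_lt j.isLt]

theorem exists_cycSucc_eq {k : ℕ} (i : Fin k) : ∃ j, cycSucc j = i := by
  obtain ⟨t, ht⟩ := exists_cycSucc_iterate_eq (cycSucc i) i
  exact ⟨cycSucc^[t] i, by rw [← Function.iterate_succ_apply' cycSucc, Function.iterate_succ_apply, ht]⟩

/-- The vertices of a closed walk reach one another. -/
theorem reflTransGen_of_cycSucc {α : Type*} {R : α → α → Prop} {k : ℕ} {c : Fin k → α}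
    (h : ∀ i, R (c i) (c (cycSucc i))) (i j : Fin k) :
    Relation.ReflTransGen R (c i) (c j) := by
  obtain ⟨t, rfl⟩ := exists_cycSucc_iterate_eq i j
  induction t with
  | zero => exact .refl
  | succ t ih =>
    rw [Function.iterate_succ_apply']
    exact ih.tail (h _)

theorem reverseCycle_apply_cycle {n k : ℕ} (d : Dir n) {c : Fin k → Fin n}
    (hc : Function.Injective c) (a : Fin n) (j : Fin k) :
    reverseCycle d c a (c j) = true ↔
      a = c (cycSucc j) ∨ (d a (c (cycSucc j)) = true ∧ a ≠ c j) := by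
  simp only [reverseCycle, decide_eq_true_eq]
  constructor
  · rintro (⟨i, hi, h⟩ | ⟨h, -⟩)
    · rwa [hc hi]
    · exact absurd rfl (h j)
  · exact fun h => .inl ⟨j, rfl, h⟩

theorem reverseCycle_apply_of_forall_ne {n k : ℕ} (d : Dir n) {c : Fin k → Fin n}
    (a : Fin n) {e : Fin n} (he : ∀ j, e ≠ c j) : reverseCycle d c a e = d a e := by
  rw [Bool.eq_iff_iff]
  simp [reverseCycle, he]

theorem reach_reverseCycle_iff {n k : ℕ} {d : Dir n} {c : Fin k → Fin n} (hc : IsCycle d c)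
    (v x : Fin n) : Reach (reverseCycle d c) v x ↔ Reach d v x := by
  have hG := reflTransGen_of_cycSucc (R := fun a b => d a b = true) hc.2
  have hH : ∀ i j, Reach (reverseCycle d c) (c i) (c j) := fun i j =>
    Relation.reflTransGen_swap.1 <| reflTransGen_of_cycSucc
      (R := Function.swap fun a b => reverseCycle d c a b = true)
      (fun i => (reverseCycle_apply_cycle d hc.1 _ i).2 (.inl rfl)) j i
  constructor
  · refine Relation.reflTransGen_closed (fun a b hab => ?_) v x
    by_cases hb : ∃ j, b = c j
    · obtain ⟨j, rfl⟩ := hb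
      rcases (reverseCycle_apply_cycle d hc.1 a j).1 hab with rfl | ⟨h, -⟩
      · exact hG _ _
      · exact .head h (hG _ _)
    · push Not at hb
      rw [reverseCycle_apply_of_forall_ne d a hb] at hab
      exact .single hab
  · refine Relation.reflTransGen_closed (fun a b hab => ?_) v x
    by_cases hb : ∃ j, b = c j
    · obtain ⟨m, rfl⟩ := hb
      obtain ⟨j, rfl⟩ := exists_cycSucc_eq m
      by_cases haj : a = c j
      · exact haj ▸ hH _ _
      · exact .head ((reverseCycle_apply_cycle d hc.1 a j).2 (.inr ⟨hab, haj⟩)) (hH _ _)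
    · push Not at hb
      exact .single ((reverseCycle_apply_of_forall_ne d a hb).trans hab)

theorem transGen_iff_reach_of_ne {n : ℕ} {d : Dir n} {v x : Fin n} (h : v ≠ x) :
    Relation.TransGen (fun a b => d a b = true) v x ↔ Reach d v x := by
  rw [Reach, Relation.reflTransGen_iff_eq_or_transGen]
  simp [h.symm]

/-- The index reversal `i ↦ -i` modulo `k` underlying `cycRev`. -/
def negIndex {k : ℕ} (i : Fin k) : Fin k :=
  ⟨(k - i.val) % k, Nat.mod_lt _ i.pos⟩

theorem negIndex_negIndex {k : ℕ} (i : Fin k) : negIndex (negIndex i) = i := by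
  have hi := i.isLt
  apply Fin.ext
  rcases Nat.eq_zero_or_pos i.val with h | h
  · simp [negIndex, h]
  · simp only [negIndex]
    rw [Nat.mod_eq_of_lt (a := k - i.val) (by omega), Nat.mod_eq_of_lt (by omega)]
    omega

theorem cycSucc_negIndex_cycSucc {k : ℕ} (i : Fin k) :
    cycSucc (negIndex (cycSucc i)) = negIndex i := by
  have hi := i.isLt
  apply Fin.ext
  simp only [negIndex, cycSucc, Nat.mod_add_mod]
  rcases Nat.lt_or_ge (i.val + 1) k with h | h
  · rw [Nat.mod_eq_of_lt h]
    congr 1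
    omega
  · have hk : i.val + 1 = k := by omega
    rw [hk, Nat.mod_self, show k - i.val = 1 by omega]
    simp

theorem reverseCycle_reverseCycle {n k : ℕ} {d : Dir n} (hd : IsDCG d) {c : Fin k → Fin n}
    (hc : IsCycle d c) : reverseCycle (reverseCycle d c) (cycRev c) = d := by
  have hr : ∀ i, cycRev c i = c (negIndex i) := fun _ => rfl
  have hinj : Function.Injective (cycRev c) :=
    hc.1.comp (Function.LeftInverse.injective negIndex_negIndex)
  funext a e
  by_cases he : ∃ m, e = c m
  · obtain ⟨m, rfl⟩ := he
    rw [Bool.eq_iff_iff]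
    have hm : c m = cycRev c (negIndex m) := by rw [hr, negIndex_negIndex]
    have hs : cycSucc (negIndex (cycSucc (negIndex m))) = m := by
      rw [cycSucc_negIndex_cycSucc, negIndex_negIndex]
    have hcyc := hc.2 (negIndex (cycSucc (negIndex m)))
    have hself := hd (c m)
    conv_lhs => rw [hm]
    rw [reverseCycle_apply_cycle _ hinj, hr, hr, negIndex_negIndex,
      reverseCycle_apply_cycle d hc.1, hs]
    rw [hs] at hcyc
    grind
  · push Not at he
    rw [reverseCycle_apply_of_forall_ne (c := cycRev c) _ a fun j => he (negIndex j), reverseCycle_apply_of_forall_ne d a he]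

/-- Lemma B.1: for a DCG `d` with cycle `c` and `H = Reverse(d, c)`:
(1) every vertex has the same descendants in `H` as in `d`; (2) reversing the reversed
cycle recovers `d`, i.e. `Reverse(H, c̄) = d`. -/
theorem reverse_cycle_properties (n k : ℕ) (hk : 2 ≤ k)
    (d : Dir n) (hd : IsDCG d)
    (c : Fin k → Fin n) (hc : IsCycle d c) :
    (∀ v x : Fin n, v ≠ x →
      (Relation.TransGen (fun a e => reverseCycle d c a e = true) v x ↔
        Relation.TransGen (fun a e => d a e = true) v x)) ∧
    reverseCycle (reverseCycle d c) (cycRev c) = d := by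
  refine ⟨fun v x h => ?_, reverseCycle_reverseCycle hd hc⟩
  rw [transGen_iff_reach_of_ne h, transGen_iff_reach_of_ne h, reach_reverseCycle_iff hc]

end CausalMEC
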